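/- There exists a constant C > 0 such that for every N ∈ ℕ with N ≥ 1 and all subsets X, Y ⊆ {0,…,N−1}: ‖𝟙_X F_N 𝟙_Y‖_{ℂ^N→ℂ^N} ≤ C·‖𝟙_{N^{−1}(X+[0,1])} F_h 𝟙_{N^{−1}(Y+[0,1])}‖_{L²(ℝ)→L²(ℝ)}, where h = (2πN)^{−1} and N^{−1}(X+[0,1]) = { (j+t)/N : j ∈ X, t ∈ [0,1] } ⊆ ℝ. -/

import Mathlib

open scoped Classical
open MeasureTheory

noncomputable section

/-- `e^{-2πi x}` -/
def ec (x : ℝ) : ℂ := Complex.exp (-(2 * Real.pi * x) * Complex.I)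

/-- The discrete Fourier transform matrix `F_N`, with entries `N^{-1/2} e^{-2πi jl/N}`. -/
def dftMatrix (N : ℕ) : Matrix (Fin N) (Fin N) ℂ :=
  Matrix.of fun j l : Fin N => ((Real.sqrt N)⁻¹ : ℝ) * ec ((j : ℕ) * (l : ℕ) / (N : ℝ))

/-- Multiplication by the indicator function of `S ⊆ {0,…,N-1}`, as a matrix on `ℂ^N`. -/
def indicatorMatrixF {N : ℕ} (S : Finset (Fin N)) : Matrix (Fin N) (Fin N) ℂ :=
  Matrix.diagonal fun j => if j ∈ S then 1 else 0

/-- The operator norm of a matrix acting on `ℂ^N` with the ℓ² norm. -/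
def opNorm {N : ℕ} (A : Matrix (Fin N) (Fin N) ℂ) : ℝ :=
  ‖Matrix.toEuclideanCLM (𝕜 := ℂ) A‖

/-- The set `N⁻¹(X + [0,1]) = { (j+t)/N : j ∈ X, t ∈ [0,1] } ⊆ ℝ`. -/
def XE (N : ℕ) (X : Finset (Fin N)) : Set ℝ :=
  ⋃ j ∈ X, Set.Icc ((j : ℝ) / (N : ℝ)) (((j : ℝ) + 1) / (N : ℝ))

/-- The semiclassical Fourier transform `F_h f(ξ) = (2πh)^{-1/2} ∫ f(x) e^{-ixξ/h} dx`. -/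
def semiclassicalFT (h : ℝ) (f : ℝ → ℂ) (ξ : ℝ) : ℂ :=
  ((Real.sqrt (2 * Real.pi * h))⁻¹ : ℝ) *
    ∫ x : ℝ, f x * Complex.exp (-((x * ξ / h : ℝ) : ℂ) * Complex.I)

lemma ec_add (x y : ℝ) : ec (x + y) = ec x * ec y := by
  unfold ec
  rw [← Complex.exp_add]
  congr 1
  push_cast
  ring

lemma norm_ec (x : ℝ) : ‖ec x‖ = 1 := by
  unfold ec
  have := Complex.norm_exp_ofReal_mul_I (-(2 * Real.pi * x))
  push_cast at this
  exact this

lemma ec_int (n : ℕ) : ec n = 1 := by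
  unfold ec
  rw [Complex.exp_eq_one_iff]
  refine ⟨-n, ?_⟩
  push_cast
  ring

lemma norm_ec_sub_one (x : ℝ) : ‖ec x - 1‖ ≤ 2 * Real.pi * |x| := by
  unfold ec
  have := Real.norm_exp_I_mul_ofReal_sub_one_le (x := -(2 * Real.pi * x))
  rw [mul_comm] at this
  push_cast at this
  refine this.trans (le_of_eq ?_)
  rw [norm_neg, Real.norm_eq_abs, abs_mul, abs_of_pos Real.two_pi_pos]

lemma continuous_ec : Continuous ec := by
  unfold ec
  fun_prop

/-- short interval at the left end of the `j`-th cell -/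
def Iv (N : ℕ) (j : Fin N) : Set ℝ := Set.Ico ((j : ℝ) / N) (((j : ℝ) + 1 / 20) / N)

/-- trigonometric polynomial -/
def Pt {N : ℕ} (w : Fin N → ℂ) (ξ : ℝ) : ℂ := ∑ l, w l * ec ((l : ℝ) * ξ)

/-- test function -/
def tf {N : ℕ} (w : Fin N → ℂ) (x : ℝ) : ℂ := ∑ l, (Iv N l).indicator (fun _ => w l) x

/-- the symbol -/
def mm (N : ℕ) (ξ : ℝ) : ℂ := ∫ y in Set.Ico (0 : ℝ) (1 / 20 / N), ec (N * y * ξ)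

lemma continuous_Pt {N : ℕ} (w : Fin N → ℂ) : Continuous (Pt w) := by
  unfold Pt
  have := continuous_ec
  fun_prop

lemma measurableSet_Iv (N : ℕ) (j : Fin N) : MeasurableSet (Iv N j) := measurableSet_Ico

lemma Iv_disj {N : ℕ} {j l : Fin N} {x : ℝ} (hj : x ∈ Iv N j) (hl : x ∈ Iv N l) : j = l := by
  have hN : (0 : ℝ) < N := by exact_mod_cast (Fin.pos j)
  obtain ⟨h1, h2⟩ := hj
  obtain ⟨h3, h4⟩ := hl
  have h5 := h1.trans_lt h4
  have h6 := h3.trans_lt h2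
  rw [div_lt_div_iff_of_pos_right hN] at h5 h6
  have h7 : (j : ℝ) < (l : ℕ) + 1 := by linarith
  have h8 : (l : ℝ) < (j : ℕ) + 1 := by linarith
  have h7' : (j : ℕ) < l + 1 := by exact_mod_cast h7
  have h8' : (l : ℕ) < j + 1 := by exact_mod_cast h8
  exact Fin.ext (by omega)

lemma Iv_sub {N : ℕ} {S : Finset (Fin N)} {j : Fin N} (hj : j ∈ S) : Iv N j ⊆ XE N S := by
  have hN : (0 : ℝ) < N := by exact_mod_cast (Fin.pos j)
  intro x hx
  unfold XE
  simp only [Set.mem_iUnion]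
  refine ⟨j, hj, hx.1, hx.2.le.trans ?_⟩
  gcongr
  norm_num

lemma tf_supp {N : ℕ} (Y : Finset (Fin N)) (w : Fin N → ℂ) (hw : ∀ l, l ∉ Y → w l = 0) :
    (XE N Y).indicator (tf w) = tf w := by
  rw [Set.indicator_eq_self]
  intro x hx
  by_contra hn
  apply hx
  unfold tf
  apply Finset.sum_eq_zero
  intro l _
  by_cases hl : l ∈ Y
  · rw [Set.indicator_of_notMem]
    exact fun h => hn (Iv_sub hl h)
  · simp [hw l hl]

lemma mm_lower {N : ℕ} (hN : 1 ≤ N) (ξ : ℝ) (h0 : 0 ≤ ξ) (h1 : ξ ≤ 1) :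
    1 / 40 / N ≤ ‖mm N ξ‖ := by
  have hN' : (0 : ℝ) < N := by exact_mod_cast hN
  have hv : volume.real (Set.Ico (0 : ℝ) (1 / 20 / N)) = 1 / 20 / N := by
    rw [Real.volume_real_Ico_of_le (by positivity)]; ring
  have hint : IntegrableOn (fun y : ℝ => ec (N * y * ξ)) (Set.Ico (0 : ℝ) (1 / 20 / N)) := by
    have := continuous_ec
    have hc : Continuous (fun y : ℝ => ec (N * y * ξ)) := by fun_prop
    exact (hc.integrableOn_Icc (a := (0 : ℝ)) (b := 1 / 20 / N)).mono_set Set.Ico_subset_Icc_self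
  have hsub : mm N ξ - (1 / 20 / N : ℝ) =
      ∫ y in Set.Ico (0 : ℝ) (1 / 20 / N), (ec (N * y * ξ) - 1) := by
    rw [integral_sub hint (by simp)]
    unfold mm
    rw [setIntegral_const, hv]
    simp
  have hb : ‖mm N ξ - (1 / 20 / N : ℝ)‖ ≤ (2 * Real.pi * (1 / 20)) * (1 / 20 / N) := by
    rw [hsub]
    have := norm_setIntegral_le_of_norm_le_const (μ := volume) (s := Set.Ico (0 : ℝ) (1 / 20 / N))
      (f := fun y : ℝ => ec (N * y * ξ) - 1) (C := 2 * Real.pi * (1 / 20)) (by simp) ?_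
    · rw [hv] at this; exact this
    · intro y hy
      refine (norm_ec_sub_one _).trans ?_
      have h2 : (N : ℝ) * y ≤ 1 / 20 := by
        have := hy.2.le
        rw [le_div_iff₀ hN'] at this
        linarith
      have h3 : 0 ≤ (N : ℝ) * y := mul_nonneg hN'.le hy.1
      have := Real.two_pi_pos
      gcongr
      rw [abs_of_nonneg (by positivity)]
      nlinarith
  have hp : 2 * Real.pi * (1 / 20) ≤ 1 / 2 := by linarith [Real.pi_lt_d2]
  have hn : ‖((1 / 20 / N : ℝ) : ℂ)‖ = 1 / 20 / N := by
    rw [Complex.norm_real, Real.norm_of_nonneg (by positivity)]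
  have ht := norm_sub_norm_le ((1 / 20 / N : ℝ) : ℂ) (mm N ξ)
  rw [norm_sub_rev, hn] at ht
  have : (2 * Real.pi * (1 / 20)) * (1 / 20 / N) ≤ 1 / 2 * (1 / 20 / N : ℝ) := by gcongr
  have e : (1 / 40 / N : ℝ) = 1 / 20 / N - 1 / 2 * (1 / 20 / N) := by ring
  rw [e]
  linarith

lemma ft_tf {N : ℕ} (hN : 1 ≤ N) (w : Fin N → ℂ) (ξ : ℝ) :
    semiclassicalFT ((2 * Real.pi * (N : ℝ))⁻¹) (tf w) ξ =
      (Real.sqrt N : ℝ) * (mm N ξ * Pt w ξ) := by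
  have hN' : (0 : ℝ) < N := by exact_mod_cast hN
  unfold semiclassicalFT
  have e1 : 2 * Real.pi * (2 * Real.pi * (N : ℝ))⁻¹ = (N : ℝ)⁻¹ := by
    have := Real.pi_pos
    field_simp
  rw [e1, Real.sqrt_inv, inv_inv]
  congr 1
  have e2 : ∀ x : ℝ, Complex.exp (-((x * ξ / (2 * Real.pi * (N : ℝ))⁻¹ : ℝ) : ℂ) * Complex.I)
      = ec (N * x * ξ) := by
    intro x
    unfold ec
    congr 2
    rw [div_inv_eq_mul]
    push_cast
    ring
  simp_rw [e2]
  unfold tf Pt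
  simp_rw [Finset.sum_mul, Finset.mul_sum]
  have e3 : ∀ (l : Fin N) (x : ℝ), (Iv N l).indicator (fun _ => w l) x * ec (N * x * ξ) =
      (Iv N l).indicator (fun x => w l * ec (N * x * ξ)) x := by
    intro l x
    by_cases hx : x ∈ Iv N l <;> simp [hx]
  simp_rw [e3]
  rw [integral_finsetSum]
  · refine Finset.sum_congr rfl fun l _ => ?_
    rw [integral_indicator (measurableSet_Iv N l), integral_const_mul]
    rw [mul_left_comm]
    congr 1
    unfold mm
    rw [← integral_mul_const]
    rw [← integral_indicator (measurableSet_Iv N l), ← integral_indicator measurableSet_Ico,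
      ← integral_add_left_eq_self _ ((l : ℝ) / N)]
    congr 1
    ext y
    have hiff : (l : ℝ) / N + y ∈ Iv N l ↔ y ∈ Set.Ico (0 : ℝ) (1 / 20 / N) := by
      unfold Iv
      rw [add_div]
      simp
    by_cases hy : y ∈ Set.Ico (0 : ℝ) (1 / 20 / N)
    · rw [Set.indicator_of_mem hy, Set.indicator_of_mem (hiff.2 hy), ← ec_add]
      congr 1
      field_simp
      ring
    · rw [Set.indicator_of_notMem hy, Set.indicator_of_notMem (fun h => hy (hiff.1 h))]
  · intro l _
    rw [integrable_indicator_iff (measurableSet_Iv N l)]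
    have := continuous_ec
    have hc : Continuous (fun y : ℝ => w l * ec (N * y * ξ)) := by fun_prop
    exact (hc.integrableOn_Icc (a := (l : ℝ) / N) (b := ((l : ℝ) + 1 / 20) / N)).mono_set
      Set.Ico_subset_Icc_self

lemma eLp_sq (f : ℝ → ℂ) : (eLpNorm f 2 volume) ^ 2 = ∫⁻ x, ‖f x‖ₑ ^ 2 := by
  have := eLpNorm_nnreal_pow_eq_lintegral (f := f) (μ := volume) (p := 2) (by norm_num)
  simpa using this

lemma tf_sq {N : ℕ} (w : Fin N → ℂ) (x : ℝ) :
    ‖tf w x‖ₑ ^ 2 = ∑ l, (Iv N l).indicator (fun _ => ‖w l‖ₑ ^ 2) x := by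
  unfold tf
  by_cases h : ∃ l0, x ∈ Iv N l0
  · obtain ⟨l0, h0⟩ := h
    have hne : ∀ l, l ≠ l0 → x ∉ Iv N l := fun l hl hx => hl (Iv_disj hx h0)
    rw [Finset.sum_eq_single l0, Finset.sum_eq_single l0]
    · simp [h0]
    · intro l _ hl
      simp [hne l hl]
    · simp
    · intro l _ hl
      simp [hne l hl]
    · simp
  · push Not at h
    simp [h]

lemma vol_Iv {N : ℕ} (l : Fin N) : volume (Iv N l) = ENNReal.ofReal (1 / 20 / N) := by
  unfold Iv
  rw [Real.volume_Ico]
  congr 1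
  ring

lemma tf_norm {N : ℕ} (w : Fin N → ℂ) :
    ∫⁻ x, ‖tf w x‖ₑ ^ 2 = ENNReal.ofReal ((∑ l, ‖w l‖ ^ 2) * (1 / 20 / N)) := by
  simp_rw [tf_sq]
  rw [lintegral_finsetSum]
  · rw [ENNReal.ofReal_mul (by positivity), ENNReal.ofReal_sum_of_nonneg (fun _ _ => by positivity),
      Finset.sum_mul]
    refine Finset.sum_congr rfl fun l _ => ?_
    rw [lintegral_indicator_const (measurableSet_Iv N l), vol_Iv, ENNReal.ofReal_pow (norm_nonneg _),
      ofReal_norm]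
  · intro l _
    exact measurable_const.indicator (measurableSet_Iv N l)

lemma tf_memLp {N : ℕ} (w : Fin N → ℂ) : MemLp (tf w) 2 volume := by
  refine ⟨?_, ?_⟩
  · apply Measurable.aestronglyMeasurable
    unfold tf
    apply Finset.measurable_fun_sum
    intro l _
    exact measurable_const.indicator (measurableSet_Iv N l)
  · have h : (eLpNorm (tf w) 2 volume) ^ 2 < ⊤ := by
      rw [eLp_sq, tf_norm]; exact ENNReal.ofReal_lt_top
    by_contra hn
    rw [not_lt, top_le_iff] at hn
    rw [hn] at h
    simp at h

lemma Iv_range {N : ℕ} {j : Fin N} {x : ℝ} (hx : x ∈ Iv N j) : 0 ≤ x ∧ x ≤ 1 := by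
  have hN : (0 : ℝ) < N := by exact_mod_cast (Fin.pos j)
  refine ⟨le_trans (by positivity) hx.1, hx.2.le.trans ?_⟩
  rw [div_le_one hN]
  have : ((j : ℕ) : ℝ) + 1 ≤ N := by exact_mod_cast j.2
  linarith

lemma lower_pt {N : ℕ} (hN : 1 ≤ N) (X : Finset (Fin N)) (w : Fin N → ℂ) (x : ℝ) :
    ∑ j ∈ X, (Iv N j).indicator (fun x => ENNReal.ofReal (1 / 1600 / N * ‖Pt w x‖ ^ 2)) x ≤
    ‖(XE N X).indicator (semiclassicalFT ((2 * Real.pi * (N : ℝ))⁻¹) (tf w)) x‖ₑ ^ 2 := by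
  have hN' : (0 : ℝ) < N := by exact_mod_cast hN
  by_cases h : ∃ j ∈ X, x ∈ Iv N j
  · obtain ⟨j, hj, hx⟩ := h
    rw [Finset.sum_eq_single_of_mem j hj]
    · rw [Set.indicator_of_mem hx, Set.indicator_of_mem (Iv_sub hj hx), ft_tf hN,
        ← ofReal_norm, ← ENNReal.ofReal_pow (norm_nonneg _)]
      apply ENNReal.ofReal_le_ofReal
      have hm := mm_lower hN x (Iv_range hx).1 (Iv_range hx).2
      rw [norm_mul, norm_mul, Complex.norm_real, Real.norm_of_nonneg (Real.sqrt_nonneg _),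
        mul_pow, mul_pow, Real.sq_sqrt hN'.le]
      calc 1 / 1600 / N * ‖Pt w x‖ ^ 2 = N * ((1 / 40 / N) ^ 2 * ‖Pt w x‖ ^ 2) := by
            field_simp
            ring
        _ ≤ _ := by gcongr
    · intro l _ hl
      rw [Set.indicator_of_notMem]
      exact fun hx' => hl (Iv_disj hx' hx)
  · push Not at h
    rw [Finset.sum_eq_zero]
    · simp
    · intro j hj
      simp [h j hj]

lemma lower_int {N : ℕ} (hN : 1 ≤ N) (X : Finset (Fin N)) (w : Fin N → ℂ) (L : ℝ)
    (hL : ∀ y ∈ Set.Ico (0 : ℝ) (1 / 20 / N),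
      L ≤ ∑ j ∈ X, 1 / N * ‖Pt w ((j : ℝ) / N + y)‖ ^ 2) :
    ENNReal.ofReal (1 / 1600 * L * (1 / 20 / N)) ≤
    ∫⁻ x, ‖(XE N X).indicator (semiclassicalFT ((2 * Real.pi * (N : ℝ))⁻¹) (tf w)) x‖ₑ ^ 2 := by
  have hN' : (0 : ℝ) < N := by exact_mod_cast hN
  refine le_trans ?_ (lintegral_mono (lower_pt hN X w))
  have hP := continuous_Pt w
  have hc : Continuous (fun x => ENNReal.ofReal (1 / 1600 / N * ‖Pt w x‖ ^ 2)) :=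
    ENNReal.continuous_ofReal.comp (by fun_prop)
  rw [lintegral_finsetSum]
  swap
  · intro l _
    exact hc.measurable.indicator (measurableSet_Iv N l)
  have e : ∀ j : Fin N,
      ∫⁻ x, (Iv N j).indicator (fun x => ENNReal.ofReal (1 / 1600 / N * ‖Pt w x‖ ^ 2)) x =
      ∫⁻ y in Set.Ico (0 : ℝ) (1 / 20 / N),
        ENNReal.ofReal (1 / 1600 / N * ‖Pt w ((j : ℝ) / N + y)‖ ^ 2) := by
    intro j
    rw [← lintegral_indicator measurableSet_Ico, ← lintegral_add_left_eq_self _ ((j : ℝ) / N)]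
    congr 1
    ext y
    have hiff : (j : ℝ) / N + y ∈ Iv N j ↔ y ∈ Set.Ico (0 : ℝ) (1 / 20 / N) := by
      unfold Iv
      rw [add_div]
      simp
    by_cases hy : y ∈ Set.Ico (0 : ℝ) (1 / 20 / N)
    · rw [Set.indicator_of_mem hy, Set.indicator_of_mem (hiff.2 hy)]
    · rw [Set.indicator_of_notMem hy, Set.indicator_of_notMem (fun h => hy (hiff.1 h))]
  simp_rw [e]
  rw [← lintegral_finsetSum]
  swap
  · intro l _
    have : Continuous (fun y => ENNReal.ofReal (1 / 1600 / N * ‖Pt w ((l : ℝ) / N + y)‖ ^ 2)) :=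
      ENNReal.continuous_ofReal.comp (by fun_prop)
    exact this.measurable
  have hconst : ∫⁻ _ in Set.Ico (0 : ℝ) (1 / 20 / N), ENNReal.ofReal (1 / 1600 * L) =
      ENNReal.ofReal (1 / 1600 * L * (1 / 20 / N)) := by
    rw [setLIntegral_const, Real.volume_Ico, sub_zero,
      ENNReal.ofReal_mul' (p := 1 / 1600 * L) (q := 1 / 20 / N) (by positivity)]
  rw [← hconst]
  apply setLIntegral_mono' measurableSet_Ico
  intro y hy
  rw [← ENNReal.ofReal_sum_of_nonneg (fun _ _ => by positivity)]
  apply ENNReal.ofReal_le_ofReal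
  have := hL y hy
  calc 1 / 1600 * L ≤ 1 / 1600 * ∑ j ∈ X, 1 / N * ‖Pt w ((j : ℝ) / N + y)‖ ^ 2 := by gcongr
    _ = _ := by
      rw [Finset.mul_sum]
      refine Finset.sum_congr rfl fun j _ => ?_
      ring

/-- twisted vector -/
def tw {N : ℕ} (y : ℝ) (u : EuclideanSpace ℂ (Fin N)) : EuclideanSpace ℂ (Fin N) :=
  WithLp.toLp 2 (fun l => ec ((l : ℝ) * y) * u l)

lemma tw_sub {N : ℕ} (hN : 1 ≤ N) (y : ℝ) (hy : y ∈ Set.Ico (0 : ℝ) (1 / 20 / N))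
    (u : EuclideanSpace ℂ (Fin N)) : ‖u - tw y u‖ ≤ 1 / 2 * ‖u‖ := by
  have hN' : (0 : ℝ) < N := by exact_mod_cast hN
  apply le_of_sq_le_sq _ (by positivity)
  rw [mul_pow, EuclideanSpace.norm_sq_eq, EuclideanSpace.norm_sq_eq, Finset.mul_sum]
  apply Finset.sum_le_sum
  intro l _
  rw [← mul_pow]
  gcongr
  have e : (u - tw y u) l = -((ec ((l : ℝ) * y) - 1) * u l) := by
    simp [tw]; ring
  rw [e, norm_neg, norm_mul]
  gcongr
  refine (norm_ec_sub_one _).trans ?_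
  have hl : ((l : ℕ) : ℝ) ≤ N := by exact_mod_cast l.2.le
  have h2 : (N : ℝ) * y ≤ 1 / 20 := by
    have := hy.2.le
    rw [le_div_iff₀ hN'] at this
    linarith
  have h0 := hy.1
  have h3 : (l : ℝ) * y ≤ 1 / 20 := le_trans (by gcongr) h2
  rw [abs_of_nonneg (by positivity)]
  nlinarith [Real.pi_lt_d2, Real.pi_pos]

lemma A_tw {N : ℕ} (hN : 1 ≤ N) (X Y : Finset (Fin N)) (y : ℝ) (u : EuclideanSpace ℂ (Fin N)) :
    ‖Matrix.toEuclideanCLM (𝕜 := ℂ) (indicatorMatrixF X * dftMatrix N * indicatorMatrixF Y)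
      (tw y u)‖ ^ 2 =
    ∑ j ∈ X, 1 / N * ‖Pt (fun l => if l ∈ Y then u l else 0) ((j : ℝ) / N + y)‖ ^ 2 := by
  have hN' : (0 : ℝ) < N := by exact_mod_cast hN
  rw [EuclideanSpace.norm_sq_eq, ← Finset.sum_filter_add_sum_filter_not Finset.univ (· ∈ X)]
  have key : ∀ j, (Matrix.toEuclideanCLM (𝕜 := ℂ)
      (indicatorMatrixF X * dftMatrix N * indicatorMatrixF Y) (tw y u)) j =
      if j ∈ X then ((Real.sqrt N)⁻¹ : ℝ) *
        Pt (fun l => if l ∈ Y then u l else 0) ((j : ℝ) / N + y) else 0 := by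
    intro j
    change ((indicatorMatrixF X * dftMatrix N * indicatorMatrixF Y).mulVec
      (fun l => ec ((l : ℝ) * y) * u l)) j = _
    unfold Matrix.mulVec dotProduct indicatorMatrixF dftMatrix Pt
    simp only [Matrix.mul_diagonal, Matrix.diagonal_mul, Matrix.of_apply]
    by_cases hj : j ∈ X
    · simp only [hj, if_true, Finset.mul_sum]
      refine Finset.sum_congr rfl fun l _ => ?_
      have e : ec ((l : ℝ) * ((j : ℝ) / N + y)) = ec ((j : ℕ) * (l : ℕ) / (N : ℝ)) * ec (l * y) := by
        rw [← ec_add]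
        congr 1
        ring
      rw [e]
      split_ifs
      · ring
      · simp
    · simp [hj]
  rw [Finset.sum_eq_zero (s := Finset.univ.filter (¬ · ∈ X))]
  · rw [add_zero]
    simp only [Finset.filter_univ_mem]
    refine Finset.sum_congr rfl fun j hj => ?_
    rw [key, if_pos hj, norm_mul, mul_pow, Complex.norm_real,
      Real.norm_of_nonneg (by positivity), inv_pow, Real.sq_sqrt hN'.le, one_div]
  · intro j hj
    rw [key, if_neg (Finset.mem_filter.1 hj).2]
    simp

/-- There is `C > 0` such that for all `N ≥ 1` and `X, Y ⊆ {0,…,N-1}`,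
`‖𝟙_X F_N 𝟙_Y‖ ≤ C ‖𝟙_{N⁻¹(X+[0,1])} F_h 𝟙_{N⁻¹(Y+[0,1])}‖_{L²(ℝ)→L²(ℝ)}` with `h = (2πN)⁻¹`
(the operator norm on the right expressed via all of its upper bounds `K`). -/
theorem stmt14 :
    ∃ C : ℝ, 0 < C ∧ ∀ N : ℕ, 1 ≤ N → ∀ X Y : Finset (Fin N), ∀ K : ℝ, 0 ≤ K →
      (∀ f : ℝ → ℂ, MemLp f 2 volume →
        eLpNorm ((XE N X).indicator
            (semiclassicalFT ((2 * Real.pi * (N : ℝ))⁻¹) ((XE N Y).indicator f))) 2 volume ≤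
          ENNReal.ofReal K * eLpNorm f 2 volume) →
      opNorm (indicatorMatrixF X * dftMatrix N * indicatorMatrixF Y) ≤ C * K := by
  refine ⟨80, by norm_num, fun N hN X Y K hK hyp => ?_⟩
  have hN' : (0 : ℝ) < N := by exact_mod_cast hN
  unfold opNorm
  set A := Matrix.toEuclideanCLM (𝕜 := ℂ) (indicatorMatrixF X * dftMatrix N * indicatorMatrixF Y)
    with hA
  have main : ‖A‖ ≤ 40 * K + 1 / 2 * ‖A‖ := by
    refine A.opNorm_le_bound (by positivity) fun u => ?_
    set L := ‖A u‖ - 1 / 2 * ‖A‖ * ‖u‖ with hLdef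
    suffices hL : L ≤ 40 * K * ‖u‖ by
      rw [hLdef] at hL
      linarith
    by_cases hL0 : L ≤ 0
    · exact hL0.trans (by positivity)
    push Not at hL0
    set w : Fin N → ℂ := fun l => if l ∈ Y then u l else 0 with hw
    have hs := tf_supp Y w (fun l hl => by simp [hw, hl])
    have h1 := hyp (tf w) (tf_memLp w)
    rw [hs] at h1
    have h2 := pow_le_pow_left' h1 2
    rw [mul_pow, eLp_sq, eLp_sq, tf_norm] at h2
    have h3 := lower_int hN X w (L ^ 2) (by
      intro y hy
      rw [hw, ← A_tw hN X Y y u, ← hA]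
      gcongr
      have h4 : ‖A u‖ ≤ ‖A (tw y u)‖ + ‖A (u - tw y u)‖ := by
        rw [map_sub]
        have := norm_add_le (A (tw y u)) (A u - A (tw y u))
        simpa using this
      have h5 := A.le_opNorm (u - tw y u)
      have h6 : ‖A‖ * ‖u - tw y u‖ ≤ ‖A‖ * (1 / 2 * ‖u‖) := by
        gcongr
        exact tw_sub hN y hy u
      rw [hLdef]
      linarith)
    have h4 := h3.trans h2
    rw [← ENNReal.ofReal_pow hK, ← ENNReal.ofReal_mul (by positivity),
      ENNReal.ofReal_le_ofReal_iff (by positivity), ← mul_assoc] at h4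
    have h5 := le_of_mul_le_mul_right h4 (by positivity)
    have h6 : ∑ l, ‖w l‖ ^ 2 ≤ ‖u‖ ^ 2 := by
      rw [EuclideanSpace.norm_sq_eq]
      apply Finset.sum_le_sum
      intro l _
      by_cases hl : l ∈ Y <;> simp [hw, hl]
    have h7 : K ^ 2 * ∑ l, ‖w l‖ ^ 2 ≤ K ^ 2 * ‖u‖ ^ 2 := by gcongr
    apply le_of_sq_le_sq _ (by positivity)
    rw [mul_pow, mul_pow]
    linarith
  linarith

end
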